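/- Let d₁ ≥ 1. There is a constant C > 0 such that for all a ∈ ℝ∖{0}, all k ∈ ℕ, and all φ ∈ L¹(ℝ^{d₁}), ||P_k(a)φ||_{L^∞} ≤ C |a|^{d₁/2} (2k + d₁)^{(d₁−1)/2} ||φ||_{L¹}. -/

import Mathlib

open MeasureTheory
open scoped ENNReal

noncomputable section

/-- Physicists' Hermite polynomial. -/
def physHermite (k : ℕ) (τ : ℝ) : ℝ :=
  (-1 : ℝ) ^ k * Real.exp (τ ^ 2) * iteratedDeriv k (fun s : ℝ => Real.exp (-s ^ 2)) τ

/-- Hermite function -/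
def hermiteFun (k : ℕ) (τ : ℝ) : ℝ :=
  ((2 : ℝ) ^ k * (Nat.factorial k) * Real.sqrt Real.pi) ^ (-(1 : ℝ) / 2) *
    physHermite k τ * Real.exp (-τ ^ 2 / 2)

/-- multi-dim Hermite function -/
def hermiteFunMulti (d : ℕ) (ν : Fin d → ℕ) (x : Fin d → ℝ) : ℝ :=
  ∏ j, hermiteFun (ν j) (x j)

/-- scaled Hermite function Φ^a_ν -/
def scaledHermite (d : ℕ) (a : ℝ) (ν : Fin d → ℕ) (x : Fin d → ℝ) : ℝ :=
  |a| ^ ((d : ℝ) / 4) * hermiteFunMulti d ν (fun j => Real.sqrt |a| * x j)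

/-- spectral projection P_k(a) -/
def hermiteProj (d k : ℕ) (a : ℝ) (φ : (Fin d → ℝ) → ℂ) (x : Fin d → ℝ) : ℂ :=
  ∑ ν ∈ Finset.Nat.antidiagonalTuple d k,
    (∫ y : Fin d → ℝ, φ y * (scaledHermite d a ν y : ℂ)) * (scaledHermite d a ν x : ℂ)

end

/-- The defining recursion of the Hermite polynomials: `H_{k+1} = 2τ H_k - H_k'`. -/
lemma hasDerivAt_physHermite_succ (k : ℕ) (τ : ℝ) :
    HasDerivAt (physHermite k) (2 * τ * physHermite k τ - physHermite (k + 1) τ) τ := by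
  have hg : ContDiff ℝ (k + 1 : ℕ) (fun s : ℝ => Real.exp (-s ^ 2)) := by fun_prop
  have h1 : HasDerivAt (iteratedDeriv k (fun s : ℝ => Real.exp (-s ^ 2)))
      (iteratedDeriv (k + 1) (fun s : ℝ => Real.exp (-s ^ 2)) τ) τ := by
    rw [iteratedDeriv_succ]
    exact (hg.differentiable_iteratedDeriv k (by exact_mod_cast Nat.lt_succ_self k) τ).hasDerivAt
  have h2 : HasDerivAt (fun t : ℝ => (-1 : ℝ) ^ k * Real.exp (t ^ 2))
      ((-1 : ℝ) ^ k * (Real.exp (τ ^ 2) * (2 * τ))) τ := by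
    have := ((hasDerivAt_pow 2 τ).exp).const_mul ((-1 : ℝ) ^ k)
    simpa using this
  refine (h2.mul h1).congr_deriv ?_
  simp only [physHermite, pow_succ]
  ring

lemma physHermite_zero (τ : ℝ) : physHermite 0 τ = 1 := by
  simp [physHermite, ← Real.exp_add]

lemma physHermite_one (τ : ℝ) : physHermite 1 τ = 2 * τ := by
  have h := hasDerivAt_physHermite_succ 0 τ
  have h0 : physHermite 0 = fun _ => 1 := funext physHermite_zero
  rw [h0] at h
  have := h.unique (hasDerivAt_const τ (1 : ℝ))
  linarith

/-- Differentiation lowers the degree: `H_{k+1}' = 2 (k+1) H_k`. -/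
lemma hasDerivAt_physHermite (k : ℕ) (τ : ℝ) :
    HasDerivAt (physHermite (k + 1)) (2 * (k + 1) * physHermite k τ) τ := by
  induction k generalizing τ with
  | zero =>
    have h1 : physHermite (0 + 1) = fun t => 2 * t := funext physHermite_one
    rw [h1]
    simpa [physHermite_zero] using (hasDerivAt_id τ).const_mul 2
  | succ k ih =>
    have hrec : physHermite (k + 1 + 1) =
        fun t => 2 * t * physHermite (k + 1) t - 2 * (k + 1) * physHermite k t := by
      funext t
      have := (hasDerivAt_physHermite_succ (k + 1) t).unique (ih t)
      linarith
    have hd := ((((hasDerivAt_id τ).const_mul 2).mul (ih τ)).sub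
      ((hasDerivAt_physHermite_succ k τ).const_mul (2 * ((k : ℝ) + 1))))
    rw [hrec]
    refine hd.congr_deriv ?_
    simp only [id, Nat.cast_add, Nat.cast_one]
    ring

/-- The `L²`-normalising constant of the Hermite functions. -/
noncomputable def hermiteNorm (k : ℕ) : ℝ :=
  ((2 : ℝ) ^ k * (Nat.factorial k) * Real.sqrt Real.pi) ^ (-(1 : ℝ) / 2)

lemma hermiteNorm_pos (k : ℕ) : 0 < hermiteNorm k := by
  unfold hermiteNorm
  positivity

lemma hermiteNorm_sq (k : ℕ) :
    hermiteNorm k ^ 2 = ((2 : ℝ) ^ k * (Nat.factorial k) * Real.sqrt Real.pi)⁻¹ := by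
  unfold hermiteNorm
  rw [← Real.rpow_natCast, ← Real.rpow_mul (by positivity), ← Real.rpow_neg_one]
  norm_num

lemma hermiteNorm_succ (k : ℕ) :
    hermiteNorm k = Real.sqrt (2 * (k + 1)) * hermiteNorm (k + 1) := by
  have h := hermiteNorm_pos k
  have h' := hermiteNorm_pos (k + 1)
  rw [← pow_left_inj₀ h.le (by positivity) two_ne_zero, mul_pow, hermiteNorm_sq, hermiteNorm_sq,
    Real.sq_sqrt (by positivity), Nat.factorial_succ]
  push_cast
  field_simp
  ring

lemma hermiteFun_eq (k : ℕ) (τ : ℝ) :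
    hermiteFun k τ = hermiteNorm k * physHermite k τ * Real.exp (-τ ^ 2 / 2) := rfl

lemma hasDerivAt_exp_neg_sq_half (τ : ℝ) :
    HasDerivAt (fun t : ℝ => Real.exp (-t ^ 2 / 2)) (-τ * Real.exp (-τ ^ 2 / 2)) τ := by
  refine (((hasDerivAt_pow 2 τ).neg.div_const 2).exp).congr_deriv ?_
  simp
  ring

/-- The creation operator: `h_k' = τ h_k - √(2(k+1)) h_{k+1}`. -/
lemma hasDerivAt_hermiteFun_raise (k : ℕ) (τ : ℝ) :
    HasDerivAt (hermiteFun k)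
      (τ * hermiteFun k τ - Real.sqrt (2 * (k + 1)) * hermiteFun (k + 1) τ) τ := by
  refine (((hasDerivAt_physHermite_succ k τ).const_mul (hermiteNorm k)).mul
    (hasDerivAt_exp_neg_sq_half τ)).congr_deriv ?_
  rw [hermiteFun_eq, hermiteFun_eq, hermiteNorm_succ k]
  ring

/-- The annihilation operator: `h_{k+1}' = -τ h_{k+1} + √(2(k+1)) h_k`. -/
lemma hasDerivAt_hermiteFun_lower (k : ℕ) (τ : ℝ) :
    HasDerivAt (hermiteFun (k + 1))
      (-τ * hermiteFun (k + 1) τ + Real.sqrt (2 * (k + 1)) * hermiteFun k τ) τ := by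
  refine (((hasDerivAt_physHermite k τ).const_mul (hermiteNorm (k + 1))).mul
    (hasDerivAt_exp_neg_sq_half τ)).congr_deriv ?_
  rw [hermiteFun_eq, hermiteFun_eq, hermiteNorm_succ k]
  have hs : Real.sqrt (2 * ((k : ℝ) + 1)) ^ 2 = 2 * (k + 1) := Real.sq_sqrt (by positivity)
  linear_combination -hermiteNorm (k + 1) * physHermite k τ * Real.exp (-τ ^ 2 / 2) * hs

lemma continuous_hermiteFun (k : ℕ) : Continuous (hermiteFun k) :=
  continuous_iff_continuousAt.2 fun τ => (hasDerivAt_hermiteFun_raise k τ).continuousAt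

lemma hermiteFun_zero (τ : ℝ) :
    hermiteFun 0 τ = hermiteNorm 0 * Real.exp (-τ ^ 2 / 2) := by
  rw [hermiteFun_eq, physHermite_zero, mul_one]

lemma exists_polynomial_eq_physHermite (k : ℕ) :
    ∃ p : Polynomial ℝ, ∀ τ, physHermite k τ = p.eval τ := by
  induction k with
  | zero => exact ⟨1, fun τ => by simp [physHermite_zero]⟩
  | succ k ih =>
    obtain ⟨p, hp⟩ := ih
    refine ⟨2 * Polynomial.X * p - Polynomial.derivative p, fun τ => ?_⟩
    have h := hasDerivAt_physHermite_succ k τ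
    rw [show physHermite k = fun t => p.eval t from funext hp] at h
    have := h.unique (p.hasDerivAt τ)
    simp only [Polynomial.eval_sub, Polynomial.eval_mul, Polynomial.eval_ofNat, Polynomial.eval_X]
    linarith

lemma exists_abs_polynomial_le_exp_sq (p : Polynomial ℝ) :
    ∃ C : ℝ, ∀ τ, |p.eval τ| ≤ C * Real.exp (τ ^ 2 / 4) := by
  induction p using Polynomial.induction_on' with
  | add p q hp hq =>
    obtain ⟨C, hC⟩ := hp
    obtain ⟨D, hD⟩ := hq
    refine ⟨C + D, fun τ => ?_⟩
    rw [Polynomial.eval_add, add_mul]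
    exact (abs_add_le _ _).trans (add_le_add (hC τ) (hD τ))
  | monomial n a =>
    refine ⟨|a| * (n.factorial * Real.exp 1), fun τ => ?_⟩
    rw [Polynomial.eval_monomial, abs_mul, abs_pow, mul_assoc]
    refine mul_le_mul_of_nonneg_left ?_ (abs_nonneg a)
    have h1 : |τ| ^ n ≤ n.factorial * Real.exp |τ| := by
      have := Real.pow_div_factorial_le_exp |τ| (abs_nonneg τ) n
      rwa [div_le_iff₀' (by positivity)] at this
    refine h1.trans ?_
    rw [mul_assoc, ← Real.exp_add]
    gcongr
    nlinarith [sq_nonneg (|τ| / 2 - 1), sq_abs τ]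

lemma exists_abs_hermiteFun_le_exp (k : ℕ) :
    ∃ C : ℝ, ∀ τ, |hermiteFun k τ| ≤ C * Real.exp (-τ ^ 2 / 4) := by
  obtain ⟨p, hp⟩ := exists_polynomial_eq_physHermite k
  obtain ⟨C, hC⟩ := exists_abs_polynomial_le_exp_sq p
  refine ⟨hermiteNorm k * C, fun τ => ?_⟩
  rw [hermiteFun_eq, hp, abs_mul, abs_mul, abs_of_pos (hermiteNorm_pos k), Real.abs_exp]
  calc hermiteNorm k * |p.eval τ| * Real.exp (-τ ^ 2 / 2)
      ≤ hermiteNorm k * (C * Real.exp (τ ^ 2 / 4)) * Real.exp (-τ ^ 2 / 2) := by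
        have := (hermiteNorm_pos k).le
        gcongr
        exact hC τ
    _ = hermiteNorm k * C * (Real.exp (τ ^ 2 / 4) * Real.exp (-τ ^ 2 / 2)) := by ring
    _ = hermiteNorm k * C * Real.exp (-τ ^ 2 / 4) := by
        rw [← Real.exp_add]
        ring_nf

lemma integrable_hermiteFun_mul (j k : ℕ) :
    Integrable (fun τ => hermiteFun j τ * hermiteFun k τ) := by
  obtain ⟨C, hC⟩ := exists_abs_hermiteFun_le_exp j
  obtain ⟨D, hD⟩ := exists_abs_hermiteFun_le_exp k
  refine ((integrable_exp_neg_mul_sq (b := 1 / 2) (by norm_num)).const_mul (C * D)).mono'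
    ((continuous_hermiteFun j).mul (continuous_hermiteFun k)).aestronglyMeasurable
    (.of_forall fun τ => ?_)
  rw [Real.norm_eq_abs, abs_mul]
  calc |hermiteFun j τ| * |hermiteFun k τ|
      ≤ (C * Real.exp (-τ ^ 2 / 4)) * (D * Real.exp (-τ ^ 2 / 4)) :=
        mul_le_mul (hC τ) (hD τ) (abs_nonneg _) ((abs_nonneg _).trans (hC τ))
    _ = C * D * (Real.exp (-τ ^ 2 / 4) * Real.exp (-τ ^ 2 / 4)) := by ring
    _ = C * D * Real.exp (-(1 / 2) * τ ^ 2) := by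
        rw [← Real.exp_add]
        ring_nf

lemma integrable_hermiteFun_sq (k : ℕ) : Integrable (fun τ => hermiteFun k τ ^ 2) := by
  simpa only [sq] using integrable_hermiteFun_mul k k

/-- The Hermite functions are normalised in `L²`. -/
lemma integral_hermiteFun_sq (k : ℕ) : ∫ τ, hermiteFun k τ ^ 2 = 1 := by
  induction k with
  | zero =>
    have h : ∀ τ : ℝ, hermiteFun 0 τ ^ 2 = hermiteNorm 0 ^ 2 * Real.exp (-1 * τ ^ 2) := by
      intro τ
      rw [hermiteFun_zero, mul_pow, ← Real.exp_nat_mul]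
      congr 2
      push_cast
      ring
    simp_rw [h]
    rw [integral_const_mul, integral_gaussian, hermiteNorm_sq]
    have : Real.sqrt Real.pi ≠ 0 := by positivity
    simp [this]
  | succ k ih =>
    have hd : ∀ τ, HasDerivAt (fun t => hermiteFun k t * hermiteFun (k + 1) t)
        (Real.sqrt (2 * (k + 1)) * (hermiteFun k τ ^ 2 - hermiteFun (k + 1) τ ^ 2)) τ := fun τ =>
      ((hasDerivAt_hermiteFun_raise k τ).mul (hasDerivAt_hermiteFun_lower k τ)).congr_deriv
        (by ring)
    have h0 := integral_eq_zero_of_hasDerivAt_of_integrable hd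
      (((integrable_hermiteFun_sq k).sub (integrable_hermiteFun_sq (k + 1))).const_mul _)
      (integrable_hermiteFun_mul k (k + 1))
    rw [integral_const_mul, integral_sub (integrable_hermiteFun_sq k)
      (integrable_hermiteFun_sq (k + 1)), ih] at h0
    have hs : Real.sqrt (2 * ((k : ℝ) + 1)) ≠ 0 := by positivity
    have := (mul_eq_zero.1 h0).resolve_left hs
    linarith

/-- The derivative of `∑_{j ≤ k} h_j²` telescopes. -/
lemma hasDerivAt_sum_hermiteFun_sq (k : ℕ) (τ : ℝ) :
    HasDerivAt (fun t => ∑ j ∈ Finset.range (k + 1), hermiteFun j t ^ 2)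
      (-Real.sqrt (2 * (k + 1)) * (hermiteFun k τ * hermiteFun (k + 1) τ)) τ := by
  induction k with
  | zero =>
    have h0 : hermiteFun 0 = fun t => hermiteNorm 0 * Real.exp (-t ^ 2 / 2) :=
      funext hermiteFun_zero
    have h := (hasDerivAt_exp_neg_sq_half τ).const_mul (hermiteNorm 0)
    rw [← h0] at h
    have hu := h.unique (hasDerivAt_hermiteFun_raise 0 τ)
    simp only [zero_add, Finset.range_one, Finset.sum_singleton]
    refine (h.pow 2).congr_deriv ?_
    have hz := hermiteFun_zero τ
    norm_num at hu ⊢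
    linear_combination -hermiteFun 0 τ * hu - hermiteFun 0 τ * τ * hz
  | succ k ih =>
    simp_rw [Finset.sum_range_succ _ (k + 1)]
    have hr := hasDerivAt_hermiteFun_raise (k + 1) τ
    have hl := hasDerivAt_hermiteFun_lower k τ
    have hu := hr.unique hl
    refine (ih.add (hr.pow 2)).congr_deriv ?_
    push_cast at hu ⊢
    norm_num at hu ⊢
    linear_combination (hermiteFun (k + 1) τ) * hu

/-- `∑_{j ≤ k} h_j(τ)² ≤ √(2(k+1))`. -/
lemma sum_hermiteFun_sq_le (k : ℕ) (τ : ℝ) :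
    ∑ j ∈ Finset.range (k + 1), hermiteFun j τ ^ 2 ≤ Real.sqrt (2 * (k + 1)) := by
  set c := Real.sqrt (2 * ((k : ℝ) + 1)) with hc
  have hint : Integrable (fun t => -c * (hermiteFun k t * hermiteFun (k + 1) t)) :=
    (integrable_hermiteFun_mul k (k + 1)).const_mul _
  have hsum : Integrable (fun t => ∑ j ∈ Finset.range (k + 1), hermiteFun j t ^ 2) :=
    integrable_finsetSum _ fun j _ => integrable_hermiteFun_sq j
  have ht := tendsto_zero_of_hasDerivAt_of_integrableOn_Ioi (a := τ)
    (fun x _ => hasDerivAt_sum_hermiteFun_sq k x) hint.integrableOn hsum.integrableOn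
  have hft := integral_Ioi_of_hasDerivAt_of_tendsto' (a := τ)
    (fun x _ => hasDerivAt_sum_hermiteFun_sq k x) hint.integrableOn ht
  rw [integral_const_mul, zero_sub] at hft
  have hle : ∫ x in Set.Ioi τ, hermiteFun k x * hermiteFun (k + 1) x ≤ 1 := by
    have hg : Integrable (fun x => (hermiteFun k x ^ 2 + hermiteFun (k + 1) x ^ 2) / 2) :=
      ((integrable_hermiteFun_sq k).add (integrable_hermiteFun_sq (k + 1))).div_const 2
    calc ∫ x in Set.Ioi τ, hermiteFun k x * hermiteFun (k + 1) x
        ≤ ∫ x in Set.Ioi τ, (hermiteFun k x ^ 2 + hermiteFun (k + 1) x ^ 2) / 2 := by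
          refine integral_mono (integrable_hermiteFun_mul k (k + 1)).integrableOn hg.integrableOn
            fun x => ?_
          have := two_mul_le_add_sq (hermiteFun k x) (hermiteFun (k + 1) x)
          change _ ≤ _
          linarith
      _ ≤ ∫ x, (hermiteFun k x ^ 2 + hermiteFun (k + 1) x ^ 2) / 2 :=
          setIntegral_le_integral hg (.of_forall fun x => by positivity)
      _ = 1 := by
          rw [integral_div, integral_add (integrable_hermiteFun_sq k)
            (integrable_hermiteFun_sq (k + 1)), integral_hermiteFun_sq, integral_hermiteFun_sq]
          norm_num
  have hc0 : 0 ≤ c := by positivity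
  nlinarith [mul_le_mul_of_nonneg_left hle hc0]

lemma iteratedDeriv_ofReal_re {f : ℂ → ℂ} (hf : Differentiable ℂ f) (k : ℕ) (τ : ℝ) :
    iteratedDeriv k (fun s : ℝ => (f s).re) τ = (iteratedDeriv k f τ).re := by
  induction k generalizing τ with
  | zero => simp
  | succ k ih =>
    rw [iteratedDeriv_succ, iteratedDeriv_succ, funext ih]
    have hd : Differentiable ℂ (iteratedDeriv k f) :=
      (hf.contDiff (n := (k + 1 : ℕ))).differentiable_iteratedDeriv k
        (by exact_mod_cast Nat.lt_succ_self k)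
    exact (hd τ).hasDerivAt.real_of_complex.deriv

/-- Cauchy's estimate for derivatives, in terms of the mean of `‖f‖` over a circle. -/
lemma norm_iteratedDeriv_le_circle_mean {f : ℂ → ℂ} (hf : Differentiable ℂ f) (c : ℂ) {R : ℝ}
    (hR : 0 < R) (k : ℕ) :
    ‖iteratedDeriv k f c‖ ≤ k.factorial *
      (((2 * Real.pi)⁻¹ * ∫ θ in (0 : ℝ)..2 * Real.pi, ‖f (circleMap c R θ)‖) * R⁻¹ ^ k) := by
  have h := (hf.hasFPowerSeriesOnBall c (R := .mk R hR.le) hR).factorial_smul 1 k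
  rw [iteratedFDeriv_apply_eq_iteratedDeriv_mul_prod, Finset.prod_const_one, one_smul] at h
  have hb := norm_cauchyPowerSeries_le f c R k
  rw [abs_of_pos hR] at hb
  rw [← h, nsmul_eq_mul, norm_mul, Complex.norm_natCast]
  gcongr
  refine le_trans ?_ hb
  refine ((cauchyPowerSeries f c R k).le_opNorm _).trans (by simp)

lemma norm_exp_neg_sq_circleMap (τ R θ : ℝ) :
    ‖Complex.exp (-(circleMap (τ : ℂ) R θ) ^ 2)‖ =
      Real.exp (-τ ^ 2 / 2 + R ^ 2) * Real.exp (-(τ + 2 * R * Real.cos θ) ^ 2 / 2) := by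
  rw [Complex.norm_exp, ← Real.exp_add]
  congr 1
  have h : circleMap (τ : ℂ) R θ =
      ((τ + R * Real.cos θ : ℝ) : ℂ) + ((R * Real.sin θ : ℝ) : ℂ) * Complex.I := by
    rw [circleMap, Complex.exp_mul_I]
    push_cast
    ring
  rw [h, sq, Complex.neg_re, Complex.mul_re]
  simp only [Complex.add_re, Complex.add_im, Complex.ofReal_re, Complex.ofReal_im, Complex.mul_re,
    Complex.mul_im, Complex.I_re, Complex.I_im]
  have := Real.sin_sq_add_cos_sq θ
  linear_combination R ^ 2 * this

/-- On `[0, π]` the cosine separates points at least quadratically. -/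
lemma sq_sub_le_abs_cos_sub_cos {s t : ℝ} (hs : s ∈ Set.Icc 0 Real.pi)
    (ht : t ∈ Set.Icc 0 Real.pi) :
    2 / Real.pi ^ 2 * (s - t) ^ 2 ≤ |Real.cos s - Real.cos t| := by
  wlog h : t ≤ s generalizing s t
  · have := this ht hs (le_of_not_ge h)
    rwa [abs_sub_comm, ← neg_sub s t, neg_sq] at this
  obtain ⟨hs0, hs1⟩ := hs
  obtain ⟨ht0, ht1⟩ := ht
  have hpi := Real.pi_pos
  have h1 : 2 / Real.pi * ((s - t) / 2) ≤ Real.sin ((s - t) / 2) :=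
    Real.mul_le_sin (by linarith) (by linarith)
  have h2 : Real.sin ((s - t) / 2) ≤ Real.sin ((s + t) / 2) := by
    rcases le_total ((s + t) / 2) (Real.pi / 2) with hle | hle
    · exact Real.sin_le_sin_of_le_of_le_pi_div_two (by linarith) hle (by linarith)
    · rw [← Real.sin_pi_sub ((s + t) / 2)]
      exact Real.sin_le_sin_of_le_of_le_pi_div_two (by linarith) (by linarith) (by linarith)
  have h0 : 0 ≤ 2 / Real.pi * ((s - t) / 2) := mul_nonneg (by positivity) (by linarith)
  rw [Real.cos_sub_cos, abs_mul, abs_mul, abs_of_nonneg (h0.trans h1),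
    abs_of_nonneg (h0.trans (h1.trans h2))]
  calc 2 / Real.pi ^ 2 * (s - t) ^ 2
      = 2 * ((2 / Real.pi * ((s - t) / 2)) * (2 / Real.pi * ((s - t) / 2))) := by
        field_simp
    _ ≤ 2 * (Real.sin ((s + t) / 2) * Real.sin ((s - t) / 2)) := by
        gcongr
        · exact h0.trans (h1.trans h2)
        · exact h1.trans h2
    _ = |(-2 : ℝ)| * Real.sin ((s + t) / 2) * Real.sin ((s - t) / 2) := by
        rw [abs_neg, abs_two]
        ring

lemma exists_sq_sub_le_abs_cos_sub (c : ℝ) :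
    ∃ t, ∀ s ∈ Set.Icc 0 Real.pi, 2 / Real.pi ^ 2 * (s - t) ^ 2 ≤ |Real.cos s - c| := by
  have hpi := Real.pi_pos.le
  rcases lt_or_ge c (-1) with hc | hc
  · refine ⟨Real.pi, fun s hs => (sq_sub_le_abs_cos_sub_cos hs ⟨hpi, le_rfl⟩).trans ?_⟩
    have := Real.neg_one_le_cos s
    rw [Real.cos_pi, abs_of_nonneg (by linarith), abs_of_nonneg (by linarith)]
    linarith
  rcases lt_or_ge 1 c with hc' | hc'
  · refine ⟨0, fun s hs => (sq_sub_le_abs_cos_sub_cos hs ⟨le_rfl, hpi⟩).trans ?_⟩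
    have := Real.cos_le_one s
    rw [Real.cos_zero, abs_of_nonpos (by linarith), abs_of_nonpos (by linarith)]
    linarith
  · refine ⟨Real.arccos c, fun s hs => ?_⟩
    have := sq_sub_le_abs_cos_sub_cos hs ⟨Real.arccos_nonneg c, Real.arccos_le_pi c⟩
    rwa [Real.cos_arccos hc hc'] at this

lemma integral_exp_neg_sq_add_cos_le (τ : ℝ) {R : ℝ} (hR : 0 < R) :
    ∫ θ in (0 : ℝ)..2 * Real.pi, Real.exp (-(τ + R * Real.cos θ) ^ 2 / 2) ≤
      2 * (Real.exp (1 / 2) * Real.sqrt (Real.pi / (2 * R / Real.pi ^ 2))) := by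
  obtain ⟨t, ht⟩ := exists_sq_sub_le_abs_cos_sub (-τ / R)
  have hpi := Real.pi_pos
  set b := 2 * R / Real.pi ^ 2 with hb
  have hb0 : 0 < b := by positivity
  set g : ℝ → ℝ := fun u => Real.exp (1 / 2) * Real.exp (-b * u ^ 2) with hg
  have hg0 : ∀ u, 0 ≤ g u := fun u => by positivity
  have hgi : Integrable g := (integrable_exp_neg_mul_sq hb0).const_mul _
  have hgint : ∫ u, g u = Real.exp (1 / 2) * Real.sqrt (Real.pi / b) := by
    rw [hg, integral_const_mul, integral_gaussian]
  have key : ∀ s ∈ Set.Icc 0 Real.pi,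
      Real.exp (-(τ + R * Real.cos s) ^ 2 / 2) ≤ g (s - t) := by
    intro s hs
    have h1 : b * (s - t) ^ 2 ≤ |τ + R * Real.cos s| := by
      have h2 : |τ + R * Real.cos s| = R * |Real.cos s - -τ / R| := by
        rw [← abs_of_pos hR, ← abs_mul, abs_of_pos hR]
        congr 1
        field_simp
        ring
      rw [h2]
      calc b * (s - t) ^ 2 = R * (2 / Real.pi ^ 2 * (s - t) ^ 2) := by rw [hb]; ring
        _ ≤ _ := by gcongr; exact ht s hs
    rw [hg]
    simp only
    rw [← Real.exp_add]
    gcongr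
    nlinarith [sq_nonneg (|τ + R * Real.cos s| - 1), sq_abs (τ + R * Real.cos s)]
  have hsum : Integrable (fun θ => g (θ - t) + g (2 * Real.pi - t - θ)) :=
    (hgi.comp_sub_right t).add (hgi.comp_sub_left (2 * Real.pi - t))
  rw [intervalIntegral.integral_of_le (by positivity)]
  calc ∫ θ in Set.Ioc 0 (2 * Real.pi), Real.exp (-(τ + R * Real.cos θ) ^ 2 / 2)
      ≤ ∫ θ in Set.Ioc 0 (2 * Real.pi), (g (θ - t) + g (2 * Real.pi - t - θ)) := by
        refine setIntegral_mono_on ?_ hsum.integrableOn measurableSet_Ioc fun θ hθ => ?_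
        · exact Continuous.integrableOn_Ioc (by fun_prop)
        · rcases le_total θ Real.pi with h | h
          · exact (key θ ⟨hθ.1.le, h⟩).trans (le_add_of_nonneg_right (hg0 _))
          · have := key (2 * Real.pi - θ) ⟨by linarith [hθ.2], by linarith⟩
            rw [Real.cos_two_pi_sub, sub_right_comm] at this
            exact this.trans (le_add_of_nonneg_left (hg0 _))
    _ ≤ ∫ θ, (g (θ - t) + g (2 * Real.pi - t - θ)) :=
        setIntegral_le_integral hsum (.of_forall fun θ => add_nonneg (hg0 _) (hg0 _))
    _ = 2 * (Real.exp (1 / 2) * Real.sqrt (Real.pi / b)) := by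
        rw [integral_add (hgi.comp_sub_right t) (hgi.comp_sub_left (2 * Real.pi - t)),
          integral_sub_right_eq_self g, integral_sub_left_eq_self g volume, hgint]
        ring

lemma factorial_succ_le_stirling (n : ℕ) :
    ((n + 1).factorial : ℝ) ≤
      Real.exp 1 * Real.sqrt (n + 1) * ((n + 1) / Real.exp 1) ^ (n + 1) := by
  have h : Stirling.stirlingSeq (n + 1) ≤ Stirling.stirlingSeq 1 :=
    Stirling.stirlingSeq'_antitone (Nat.zero_le n)
  rw [Stirling.stirlingSeq_one, Stirling.stirlingSeq, div_le_iff₀ (by positivity)] at h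
  refine h.trans (le_of_eq ?_)
  push_cast
  rw [Real.sqrt_mul (by norm_num)]
  have : Real.sqrt 2 ≠ 0 := by positivity
  field_simp

lemma abs_hermiteFun_le_integral (k : ℕ) (τ : ℝ) {R : ℝ} (hR : 0 < R) :
    |hermiteFun k τ| ≤ hermiteNorm k * k.factorial * R⁻¹ ^ k * Real.exp (R ^ 2) *
      ∫ θ in (0 : ℝ)..2 * Real.pi, Real.exp (-(τ + 2 * R * Real.cos θ) ^ 2 / 2) := by
  have hf : Differentiable ℂ (fun z : ℂ => Complex.exp (-z ^ 2)) := by fun_prop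
  have hre : (fun s : ℝ => Real.exp (-s ^ 2)) =
      fun s : ℝ => (Complex.exp (-(s : ℂ) ^ 2)).re := by
    funext s
    rw [← Complex.ofReal_pow, ← Complex.ofReal_neg, Complex.exp_ofReal_re]
  set I := ∫ θ in (0 : ℝ)..2 * Real.pi, Real.exp (-(τ + 2 * R * Real.cos θ) ^ 2 / 2) with hI
  have hI0 : 0 ≤ I := 
    intervalIntegral.integral_nonneg (by positivity) fun θ _ => (Real.exp_pos _).le
  have hder : |iteratedDeriv k (fun s : ℝ => Real.exp (-s ^ 2)) τ| ≤
      k.factorial * (Real.exp (-τ ^ 2 / 2 + R ^ 2) * I * R⁻¹ ^ k) := by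
    rw [hre, iteratedDeriv_ofReal_re hf k τ]
    refine (Complex.abs_re_le_norm _).trans
      ((norm_iteratedDeriv_le_circle_mean hf τ hR k).trans ?_)
    simp_rw [norm_exp_neg_sq_circleMap]
    rw [intervalIntegral.integral_const_mul, ← hI]
    have hpi : (2 * Real.pi)⁻¹ ≤ 1 := inv_le_one_of_one_le₀ (by linarith [Real.pi_gt_three])
    refine mul_le_mul_of_nonneg_left (mul_le_mul_of_nonneg_right ?_ (by positivity))
      (by positivity)
    exact mul_le_of_le_one_left (by positivity) hpi
  rw [hermiteFun_eq, physHermite, abs_mul, abs_mul, abs_mul, abs_mul, abs_pow, abs_neg, abs_one,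
    one_pow, one_mul, Real.abs_exp, Real.abs_exp, abs_of_pos (hermiteNorm_pos k)]
  have hN := (hermiteNorm_pos k).le
  calc hermiteNorm k * (Real.exp (τ ^ 2) * |iteratedDeriv k (fun s : ℝ => Real.exp (-s ^ 2)) τ|) *
        Real.exp (-τ ^ 2 / 2)
      ≤ hermiteNorm k * (Real.exp (τ ^ 2) *
          (k.factorial * (Real.exp (-τ ^ 2 / 2 + R ^ 2) * I * R⁻¹ ^ k))) *
          Real.exp (-τ ^ 2 / 2) := by gcongr
    _ = hermiteNorm k * k.factorial * R⁻¹ ^ k *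
        (Real.exp (τ ^ 2) * Real.exp (-τ ^ 2 / 2 + R ^ 2) * Real.exp (-τ ^ 2 / 2)) * I := by ring
    _ = hermiteNorm k * k.factorial * R⁻¹ ^ k * Real.exp (R ^ 2) * I := by
        rw [← Real.exp_add, ← Real.exp_add]
        ring_nf

/-- The Hermite functions are bounded uniformly in the degree. -/
lemma exists_hermiteFun_sq_le : ∃ B : ℝ, 0 < B ∧ ∀ k τ, hermiteFun k τ ^ 2 ≤ B := by
  have hpi := Real.pi_pos
  refine ⟨Real.exp 1 ^ 3 * Real.sqrt Real.pi * Real.pi ^ 2 * 4, by positivity, fun k τ => ?_⟩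
  set n : ℝ := (k : ℝ) + 1 with hn
  have hn0 : 0 < n := by positivity
  set R := Real.sqrt (n / 2) with hRdef
  have hR : 0 < R := by positivity
  have hR2 : R ^ 2 = n / 2 := Real.sq_sqrt (by positivity)
  have h1 := abs_hermiteFun_le_integral k τ hR
  have h2 := integral_exp_neg_sq_add_cos_le τ (R := 2 * R) (by positivity)
  have hN := hermiteNorm_pos k
  have h3 := h1.trans (mul_le_mul_of_nonneg_left h2 (by positivity))
  have h4 := pow_le_pow_left₀ (abs_nonneg _) h3 2
  rw [sq_abs] at h4
  refine h4.trans ?_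
  have hfac := factorial_succ_le_stirling k
  rw [← hn, Nat.factorial_succ] at hfac
  push_cast at hfac
  rw [← hn] at hfac
  have hsn : Real.sqrt n = Real.sqrt 2 * R := by
    rw [hRdef, ← Real.sqrt_mul (by norm_num)]
    congr 1
    ring
  have hfac' : (k.factorial : ℝ) * Real.exp n ≤ Real.exp 1 * Real.sqrt n * n ^ k := by
    have he : Real.exp n = Real.exp 1 ^ (k + 1) := by
      rw [← Real.exp_nat_mul, hn]
      push_cast
      ring_nf
    rw [div_pow, ← he, mul_div_assoc', le_div_iff₀ (Real.exp_pos n), pow_succ] at hfac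
    refine le_of_mul_le_mul_left ?_ hn0
    linarith
  have hpow : (R⁻¹ ^ k) ^ 2 = 2 ^ k / n ^ k := by
    rw [← pow_mul, mul_comm, pow_mul, inv_pow, hR2, inv_div, div_pow]
  have hexp : Real.exp (R ^ 2) ^ 2 = Real.exp n := by
    rw [← Real.exp_nat_mul, hR2]
    congr 1
    push_cast
    ring
  have hexp2 : Real.exp (1 / 2) ^ 2 = Real.exp 1 := by
    rw [← Real.exp_nat_mul]
    norm_num
  have hsq : Real.sqrt (Real.pi / (2 * (2 * R) / Real.pi ^ 2)) ^ 2 =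
      Real.pi / (2 * (2 * R) / Real.pi ^ 2) := Real.sq_sqrt (by positivity)
  have hspi : Real.sqrt Real.pi ^ 2 = Real.pi := Real.sq_sqrt hpi.le
  have hs2 : Real.sqrt 2 ≤ 2 := by
    rw [Real.sqrt_le_left (by norm_num)]
    norm_num
  simp only [mul_pow]
  rw [hermiteNorm_sq, hpow, hexp, hexp2, hsq]
  calc _ = ((k.factorial : ℝ) * Real.exp n) * (Real.exp 1 * Real.pi ^ 3) /
        (n ^ k * Real.sqrt Real.pi * R) := by
        field_simp
    _ ≤ (Real.exp 1 * Real.sqrt n * n ^ k) * (Real.exp 1 * Real.pi ^ 3) /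
        (n ^ k * Real.sqrt Real.pi * R) := by gcongr
    _ = Real.exp 1 ^ 2 * Real.sqrt 2 * (Real.sqrt Real.pi * Real.pi ^ 2) := by
        rw [hsn]
        have hspi' : Real.sqrt Real.pi ≠ 0 := by positivity
        field_simp
        rw [hspi]
    _ ≤ Real.exp 1 ^ 3 * 2 * (Real.sqrt Real.pi * Real.pi ^ 2) := by
        gcongr
        · exact Real.one_le_exp zero_le_one
        · norm_num
    _ ≤ _ := by
        have : 0 ≤ Real.exp 1 ^ 3 * (Real.sqrt Real.pi * Real.pi ^ 2) := by positivity
        linarith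

lemma sum_antidiagonalTuple_prod_hermiteFun_sq_le {B : ℝ} (hB : 0 ≤ B)
    (h : ∀ k τ, hermiteFun k τ ^ 2 ≤ B) (n k : ℕ) (x : Fin (n + 1) → ℝ) :
    ∑ ν ∈ Finset.Nat.antidiagonalTuple (n + 1) k, hermiteFunMulti (n + 1) ν x ^ 2 ≤
      B * Real.sqrt (2 * (k + 1)) ^ n := by
  have hinj : Set.InjOn (fun ν : Fin (n + 1) → ℕ => Fin.tail ν)
      (Finset.Nat.antidiagonalTuple (n + 1) k) := by
    intro ν hν μ hμ hνμ
    rw [Finset.mem_coe, Finset.Nat.mem_antidiagonalTuple, Fin.sum_univ_succ] at hν hμ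
    have ht : ∀ i : Fin n, ν i.succ = μ i.succ := fun i => congrFun hνμ i
    funext i
    refine Fin.cases ?_ ht i
    simp_rw [ht] at hν
    lia
  have hsub : (Finset.Nat.antidiagonalTuple (n + 1) k).image
      (fun ν : Fin (n + 1) → ℕ => Fin.tail ν) ⊆
      Fintype.piFinset fun _ : Fin n => Finset.range (k + 1) := by
    intro μ hμ
    obtain ⟨ν, hν, rfl⟩ := Finset.mem_image.1 hμ
    rw [Finset.Nat.mem_antidiagonalTuple] at hν
    refine Fintype.mem_piFinset.2 fun i => Finset.mem_range_succ_iff.2 ?_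
    rw [← hν]
    exact Finset.single_le_sum (f := ν) (fun _ _ => Nat.zero_le _) (Finset.mem_univ i.succ)
  calc ∑ ν ∈ Finset.Nat.antidiagonalTuple (n + 1) k, hermiteFunMulti (n + 1) ν x ^ 2
      ≤ ∑ ν ∈ Finset.Nat.antidiagonalTuple (n + 1) k,
          B * ∏ i : Fin n, hermiteFun (Fin.tail ν i) (x i.succ) ^ 2 := by
        refine Finset.sum_le_sum fun ν _ => ?_
        rw [hermiteFunMulti, Fin.prod_univ_succ, mul_pow, ← Finset.prod_pow]
        exact mul_le_mul_of_nonneg_right (h _ _) (Finset.prod_nonneg fun _ _ => sq_nonneg _)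
    _ = B * ∑ μ ∈ (Finset.Nat.antidiagonalTuple (n + 1) k).image (fun ν => Fin.tail ν),
          ∏ i : Fin n, hermiteFun (μ i) (x i.succ) ^ 2 := by
        rw [Finset.sum_image hinj, Finset.mul_sum]
    _ ≤ B * ∑ μ ∈ Fintype.piFinset fun _ : Fin n => Finset.range (k + 1),
          ∏ i : Fin n, hermiteFun (μ i) (x i.succ) ^ 2 := by
        refine mul_le_mul_of_nonneg_left (Finset.sum_le_sum_of_subset_of_nonneg hsub
          fun _ _ _ => Finset.prod_nonneg fun _ _ => sq_nonneg _) hB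
    _ = B * ∏ i : Fin n, ∑ j ∈ Finset.range (k + 1), hermiteFun j (x i.succ) ^ 2 := by
        rw [Finset.sum_prod_piFinset (Finset.range (k + 1))
          fun i j => hermiteFun j (x (Fin.succ i)) ^ 2]
    _ ≤ B * ∏ _i : Fin n, Real.sqrt (2 * (k + 1)) := by
        refine mul_le_mul_of_nonneg_left (Finset.prod_le_prod
          (fun _ _ => Finset.sum_nonneg fun _ _ => sq_nonneg _)
          fun i _ => sum_hermiteFun_sq_le k (x i.succ)) hB
    _ = B * Real.sqrt (2 * (k + 1)) ^ n := by simp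

lemma scaledHermite_sq (d : ℕ) (a : ℝ) (ν : Fin d → ℕ) (x : Fin d → ℝ) :
    scaledHermite d a ν x ^ 2 =
      |a| ^ ((d : ℝ) / 2) * hermiteFunMulti d ν (fun j => Real.sqrt |a| * x j) ^ 2 := by
  rw [scaledHermite, mul_pow, ← Real.rpow_natCast, ← Real.rpow_mul (abs_nonneg a)]
  congr 2
  push_cast
  ring

lemma continuous_scaledHermite (d : ℕ) (a : ℝ) (ν : Fin d → ℕ) :
    Continuous (scaledHermite d a ν) := by
  unfold scaledHermite hermiteFunMulti
  refine continuous_const.mul (continuous_finsetProd _ fun j _ => ?_)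
  exact (continuous_hermiteFun (ν j)).comp (by fun_prop)

/-- A finite-rank operator `φ ↦ ∑ ν, ⟨φ, e_ν⟩ e_ν` maps `L¹` to `L^∞` with norm at most the
supremum of `∑ ν, |e_ν|²`. -/
lemma norm_sum_integral_mul_le {ι α : Type*} [MeasurableSpace α] {μ : Measure α} (s : Finset ι)
    {e : ι → α → ℝ} {M : ℝ} (he : ∀ ν, AEStronglyMeasurable (e ν) μ)
    (hM : ∀ x, ∑ ν ∈ s, e ν x ^ 2 ≤ M) {φ : α → ℂ} (hφ : Integrable φ μ) (x : α) :
    ‖∑ ν ∈ s, (∫ y, φ y * (e ν y : ℂ) ∂μ) * (e ν x : ℂ)‖ ≤ M * ∫ y, ‖φ y‖ ∂μ := by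
  have hint : ∀ ν ∈ s, Integrable (fun y => φ y * (e ν y : ℂ) * (e ν x : ℂ)) μ := by
    intro ν hν
    refine (hφ.mul_bdd (c := Real.sqrt M) ?_ (.of_forall fun y => ?_)).mul_const _
    · exact Complex.continuous_ofReal.comp_aestronglyMeasurable (he ν)
    · rw [Complex.norm_real]
      exact Real.abs_le_sqrt ((Finset.single_le_sum (f := fun ν => e ν y ^ 2)
        (fun _ _ => sq_nonneg _) hν).trans (hM y))
  simp_rw [← integral_mul_const]
  rw [← integral_finsetSum s hint, ← integral_const_mul]
  refine norm_integral_le_of_norm_le (hφ.norm.const_mul M) (.of_forall fun y => ?_)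
  have hfac : ∑ ν ∈ s, φ y * (e ν y : ℂ) * (e ν x : ℂ) =
      φ y * ((∑ ν ∈ s, e ν y * e ν x : ℝ) : ℂ) := by
    push_cast
    rw [Finset.mul_sum]
    exact Finset.sum_congr rfl fun ν _ => by ring
  rw [hfac, norm_mul, Complex.norm_real, mul_comm M]
  refine mul_le_mul_of_nonneg_left ?_ (norm_nonneg _)
  rw [Real.norm_eq_abs]
  calc |∑ ν ∈ s, e ν y * e ν x| ≤ ∑ ν ∈ s, |e ν y * e ν x| := Finset.abs_sum_le_sum_abs _ _
    _ ≤ ∑ ν ∈ s, (e ν y ^ 2 + e ν x ^ 2) / 2 := by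
        refine Finset.sum_le_sum fun ν _ => ?_
        rw [abs_mul]
        have := two_mul_le_add_sq |e ν y| |e ν x|
        rw [sq_abs, sq_abs] at this
        linarith
    _ = (∑ ν ∈ s, e ν y ^ 2 + ∑ ν ∈ s, e ν x ^ 2) / 2 := by
        rw [← Finset.sum_div, Finset.sum_add_distrib]
    _ ≤ M := by linarith [hM x, hM y]

theorem hermite_proj_L1_Linfty_bound (d : ℕ) (hd : 1 ≤ d) :
    ∃ C > (0 : ℝ), ∀ (a : ℝ), a ≠ 0 → ∀ (k : ℕ) (φ : (Fin d → ℝ) → ℂ),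
      Integrable φ volume →
      eLpNorm (hermiteProj d k a φ) ∞ volume ≤
        ENNReal.ofReal (C * |a| ^ ((d : ℝ) / 2) * (2 * (k : ℝ) + d) ^ (((d : ℝ) - 1) / 2)) *
          eLpNorm φ 1 volume := by
  obtain ⟨n, rfl⟩ := Nat.exists_eq_add_of_le' hd
  obtain ⟨B, hB, hb⟩ := exists_hermiteFun_sq_le
  refine ⟨B * Real.sqrt 2 ^ n, by positivity, fun a _ k φ hφ => ?_⟩
  have hgrowth : Real.sqrt (2 * ((k : ℝ) + 1)) ^ n ≤
      Real.sqrt 2 ^ n * (2 * (k : ℝ) + (n + 1 : ℕ)) ^ ((((n + 1 : ℕ) : ℝ) - 1) / 2) := by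
    have hexp : (((n + 1 : ℕ) : ℝ) - 1) / 2 = 1 / 2 * n := by
      push_cast
      ring
    rw [hexp, Real.rpow_mul (by positivity), ← Real.sqrt_eq_rpow, Real.rpow_natCast, ← mul_pow,
      ← Real.sqrt_mul (by norm_num)]
    refine pow_le_pow_left₀ (Real.sqrt_nonneg _) (Real.sqrt_le_sqrt ?_) n
    push_cast
    linarith [(Nat.cast_nonneg k : (0 : ℝ) ≤ k), (Nat.cast_nonneg n : (0 : ℝ) ≤ n)]
  have hM : ∀ x, ∑ ν ∈ Finset.Nat.antidiagonalTuple (n + 1) k,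
      scaledHermite (n + 1) a ν x ^ 2 ≤ B * Real.sqrt 2 ^ n * |a| ^ (((n + 1 : ℕ) : ℝ) / 2) *
        (2 * (k : ℝ) + (n + 1 : ℕ)) ^ ((((n + 1 : ℕ) : ℝ) - 1) / 2) := by
    intro x
    simp_rw [scaledHermite_sq]
    rw [← Finset.mul_sum]
    calc _ ≤ |a| ^ (((n + 1 : ℕ) : ℝ) / 2) * (B * (Real.sqrt 2 ^ n *
          (2 * (k : ℝ) + (n + 1 : ℕ)) ^ ((((n + 1 : ℕ) : ℝ) - 1) / 2))) := by
          gcongr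
          exact (sum_antidiagonalTuple_prod_hermiteFun_sq_le hB.le hb n k _).trans
            (mul_le_mul_of_nonneg_left hgrowth hB.le)
      _ = _ := by ring
  rw [eLpNorm_one_eq_lintegral_enorm, ← ofReal_integral_norm_eq_lintegral_enorm hφ,
    ← ENNReal.ofReal_mul (by positivity), eLpNorm_exponent_top]
  exact eLpNormEssSup_le_of_ae_bound (.of_forall fun x =>
    norm_sum_integral_mul_le _
      (fun ν => (continuous_scaledHermite (n + 1) a ν).aestronglyMeasurable) hM hφ x)
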